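/- (GL_2(ℝ): a sum of two characters and an irreducible 2-dimensional parameter cannot have the same central character and the same GL(1)-twisted L-factors.) There do not exist ε₁, ε₂ ∈ ℕ with ε₁, ε₂ ≤ 1, complex numbers t₁, t₂, u' ∈ ℂ, and an integer N' ≥ 1, such that: (central character equality) t₁ + t₂ − (ε₁ + ε₂) = 2u' − N' and ε₁ + ε₂ ≡ 1 + N' (mod 2); and (L-factor equality) for every δ ∈ {0,1} and every s ∈ ℂ, π^{−(s + t₁ − γ(ε₁,δ))/2}·Γ((s + t₁ − γ(ε₁,δ))/2) · π^{−(s + t₂ − γ(ε₂,δ))/2}·Γ((s + t₂ − γ(ε₂,δ))/2) = 2·(2π)^{−(s + u' − δ)}·Γ(s + u' − δ), where γ(ε,δ) = 2 if ε = δ = 1 and γ(ε,δ) = 0 otherwise. -/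

import Mathlib

open Complex

/-- `γ(ε, δ) = 2` if `ε = δ = 1` and `0` otherwise. -/
def gam (e d : ℕ) : ℕ := if e = 1 ∧ d = 1 then 2 else 0

/-- If the poles of `Γ((s + x) / 2) Γ((s + y) / 2)` and of `Γ(s + v)` agree as sets, then
`{x, y} = {v, v + 1}`. -/
theorem eq_and_eq_add_one_of_Gamma_half_zeros {x y v : ℂ}
    (h : ∀ s : ℂ, (Complex.Gamma ((s + x) / 2) = 0 ∨ Complex.Gamma ((s + y) / 2) = 0) ↔
      Complex.Gamma (s + v) = 0) :
    (x = v ∧ y = v + 1) ∨ (y = v ∧ x = v + 1) := by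
  simp only [Complex.Gamma_eq_zero_iff] at h
  obtain ⟨a, ha⟩ := (h (-x)).1 (Or.inl ⟨0, by simp⟩)
  obtain ⟨b, hb⟩ := (h (-y)).1 (Or.inr ⟨0, by simp⟩)
  have hx : x = v + a := by linear_combination -ha
  have hy : y = v + b := by linear_combination -hb
  have h0 := (h (-v)).2 ⟨0, by simp⟩
  have h1 := (h (-v - 1)).2 ⟨1, by push_cast; ring⟩
  have zeros_nat {c k m : ℕ} {z : ℂ} (hz : z = v + c) (hk : (-v - k + z) / 2 = -(m : ℂ)) :
      c + 2 * m = k := by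
    have : (c : ℂ) + 2 * m = k := by linear_combination 2 * hk - hz
    exact_mod_cast this
  have h0' : a = 0 ∨ b = 0 := by
    rcases h0 with ⟨m, hm⟩ | ⟨m, hm⟩
    · have := zeros_nat (k := 0) hx (by simpa using hm)
      omega
    · have := zeros_nat (k := 0) hy (by simpa using hm)
      omega
  have h1' : a = 1 ∨ b = 1 := by
    rcases h1 with ⟨m, hm⟩ | ⟨m, hm⟩
    · have := zeros_nat (k := 1) hx (by simpa using hm)
      omega
    · have := zeros_nat (k := 1) hy (by simpa using hm)
      omega
  have hab : (a = 0 ∧ b = 1) ∨ (b = 0 ∧ a = 1) := by omega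
  rcases hab with ⟨rfl, rfl⟩ | ⟨rfl, rfl⟩
  · left; simpa using And.intro hx hy
  · right; simpa using And.intro hy hx

theorem GL2_real_no_mixed_parameters :
    ¬ ∃ (ε₁ ε₂ : ℕ) (t₁ t₂ u' : ℂ) (N' : ℤ),
      ε₁ ≤ 1 ∧ ε₂ ≤ 1 ∧ 1 ≤ N' ∧
      (t₁ + t₂ - ((ε₁ : ℂ) + ε₂) = 2 * u' - (N' : ℂ)) ∧
      ((ε₁ : ℤ) + ε₂ ≡ 1 + N' [ZMOD 2]) ∧
      (∀ δ : ℕ, δ ≤ 1 → ∀ s : ℂ,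
        (Real.pi : ℂ) ^ (-((s + t₁ - (gam ε₁ δ : ℂ)) / 2)) *
            Complex.Gamma ((s + t₁ - (gam ε₁ δ : ℂ)) / 2) *
          ((Real.pi : ℂ) ^ (-((s + t₂ - (gam ε₂ δ : ℂ)) / 2)) *
            Complex.Gamma ((s + t₂ - (gam ε₂ δ : ℂ)) / 2))
        = 2 * (2 * (Real.pi : ℂ)) ^ (-(s + u' - (δ : ℂ))) *
            Complex.Gamma (s + u' - (δ : ℂ))) := by
  rintro ⟨ε₁, ε₂, t₁, t₂, u', N', hε₁, hε₂, hN, hcentral, -, hL⟩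
  have hpi : (Real.pi : ℂ) ≠ 0 := by exact_mod_cast Real.pi_ne_zero
  have hpoles (δ : ℕ) (hδ : δ ≤ 1) :=
    eq_and_eq_add_one_of_Gamma_half_zeros (x := t₁ - gam ε₁ δ) (y := t₂ - gam ε₂ δ)
      (v := u' - δ) fun s => by
        have := congrArg (· = 0) (hL δ hδ s)
        simpa [Complex.cpow_eq_zero_iff, hpi, add_sub_assoc] using this
  have hN0 : (N' : ℂ) ≠ 0 := by exact_mod_cast (by omega : N' ≠ 0)
  have hsum : t₁ + t₂ = 2 * u' + 1 := by
    rcases hpoles 0 zero_le_one with ⟨h, h'⟩ | ⟨h, h'⟩ <;> simp [gam] at h h' <;>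
      linear_combination h + h'
  have hgam (ε : ℕ) (hε : ε ≤ 1) : (gam ε 1 : ℂ) = 2 * ε := by
    interval_cases ε <;> simp [gam]
  have hε : (ε₁ : ℂ) + ε₂ = 1 := by
    rcases hpoles 1 le_rfl with ⟨h, h'⟩ | ⟨h, h'⟩ <;>
      rw [hgam _ hε₁] at * <;> rw [hgam _ hε₂] at * <;> push_cast at h h' <;>
      linear_combination (hsum - h - h') / 2
  exact hN0 (by linear_combination hcentral - hsum + hε)
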